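/- Let $\mathbf{d} = (d_1,\dots,d_n)$ be nonnegative integers with $d = \sum_i d_i$, and let $I_{\mathbf{d}} = (x_1^{d_1+1},\dots,x_n^{d_n+1}, x_1+\cdots+x_n) \subseteq \mathbb{F}[x_1,\dots,x_n]$ over a characteristic-zero field. Then the Hilbert series of $R_{\mathbf{d}} = \mathbb{F}[x_1,\dots,x_n]/I_{\mathbf{d}}$ equals the truncation to degrees $\le d/2$ of $(1-q) \prod_{i=1}^n (1 + q + \cdots + q^{d_i})$. -/

import Mathlib

open MvPolynomial

/-- The degree-`m` piece of the quotient of `F[x₁,…,xₙ]` by a homogeneous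
ideal `I`: the image of the homogeneous polynomials of degree `m`. -/
noncomputable def gradedPiece {n : ℕ} (F : Type*) [Field F]
    (I : Ideal (MvPolynomial (Fin n) F)) (m : ℕ) :
    Submodule F (MvPolynomial (Fin n) F ⧸ I) :=
  (MvPolynomial.homogeneousSubmodule (Fin n) F m).map
    (Ideal.Quotient.mkₐ F I).toLinearMap

namespace MvPolynomial

variable {σ K : Type*} [Field K]

/-- The ideal generated by the powers `X i ^ (d i + 1)`. -/
noncomputable def powIdeal (K : Type*) [Field K] (d : σ → ℕ) : Ideal (MvPolynomial σ K) :=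
  Ideal.span {f | ∃ i, f = X i ^ (d i + 1)}

theorem mem_powIdeal_iff {d : σ → ℕ} {f : MvPolynomial σ K} :
    f ∈ powIdeal K d ↔ ∀ a ∈ f.support, ∃ i, d i < a i := by
  have h : {f : MvPolynomial σ K | ∃ i, f = X i ^ (d i + 1)} =
      (fun s ↦ monomial s (1 : K)) '' Set.range fun i ↦ Finsupp.single i (d i + 1) := by
    ext f
    simp [X_pow_eq_monomial, eq_comm]
  simp [powIdeal, h, mem_ideal_span_monomial_image, -Finsupp.single_add]

theorem IsHomogeneous.mem_powIdeal_of_lt [Fintype σ] {d : σ → ℕ} {f : MvPolynomial σ K} {m : ℕ}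
    (hf : f.IsHomogeneous m) (hm : ∑ i, d i < m) : f ∈ powIdeal K d := by
  rw [mem_powIdeal_iff]
  intro a ha
  by_contra! h
  have hdeg := hf.degree_eq_sum_deg_support ha
  rw [← Finsupp.degree_apply, Finsupp.degree_eq_sum] at hdeg
  exact (hdeg ▸ Finset.sum_le_sum fun i _ ↦ h i).not_gt hm

theorem homogeneousComponent_mem_powIdeal {d : σ → ℕ} {f : MvPolynomial σ K}
    (hf : f ∈ powIdeal K d) (m : ℕ) : homogeneousComponent m f ∈ powIdeal K d := by
  classical
  rw [mem_powIdeal_iff] at hf ⊢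
  intro a ha
  rw [support_homogeneousComponent] at ha
  exact hf a (Finset.mem_filter.mp ha).1

section

attribute [local instance] MvPolynomial.gradedAlgebra

theorem homogeneousComponent_add_mul {f : MvPolynomial σ K} {k : ℕ} (hf : f.IsHomogeneous k)
    (g : MvPolynomial σ K) (m : ℕ) :
    homogeneousComponent (k + m) (f * g) = f * homogeneousComponent m g := by
  simp only [← decomposition.decompose'_apply]
  exact DirectSum.coe_decompose_mul_add_of_left_mem (homogeneousSubmodule σ K) hf

theorem homogeneousComponent_mul_of_lt {f : MvPolynomial σ K} {k m : ℕ} (hf : f.IsHomogeneous k)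
    (g : MvPolynomial σ K) (hm : m < k) : homogeneousComponent m (f * g) = 0 := by
  rw [← decomposition.decompose'_apply]
  exact DirectSum.coe_decompose_mul_of_left_mem_of_not_le (homogeneousSubmodule σ K) hf hm.not_ge

end

theorem intCast_mul_mem_iff [CharZero K] {J : Ideal (MvPolynomial σ K)} {c : ℤ} (hc : c ≠ 0)
    {f : MvPolynomial σ K} : (c : MvPolynomial σ K) * f ∈ J ↔ f ∈ J := by
  refine J.unit_mul_mem_iff_mem ?_
  rw [← map_intCast (C : K →+* MvPolynomial σ K)]
  exact (IsUnit.mk0 _ (Int.cast_ne_zero.mpr hc)).map C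

section Lowering

variable [Fintype σ]

/-- The differential operator `∑ i, (d i • ∂ᵢ - xᵢ ∂ᵢ²)`. Together with multiplication by `∑ i, xᵢ`,
it makes the quotient by `powIdeal K d` a representation of `𝔰𝔩₂`. -/
noncomputable def lowering (d : σ → ℕ) (f : MvPolynomial σ K) : MvPolynomial σ K :=
  ∑ i, ((d i : MvPolynomial σ K) * pderiv i f - X i * pderiv i (pderiv i f))

theorem lowering_add (d : σ → ℕ) (f g : MvPolynomial σ K) :
    lowering d (f + g) = lowering d f + lowering d g := by
  simp only [lowering, map_add, ← Finset.sum_add_distrib]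
  exact Finset.sum_congr rfl fun i _ ↦ by ring

theorem lowering_zero (d : σ → ℕ) : lowering d (0 : MvPolynomial σ K) = 0 := by
  simp [lowering]

theorem lowering_intCast_mul (d : σ → ℕ) (c : ℤ) (f : MvPolynomial σ K) :
    lowering d ((c : MvPolynomial σ K) * f) = c * lowering d f := by
  simp only [lowering, ← zsmul_eq_mul, map_zsmul, Finset.smul_sum, smul_sub, mul_smul_comm]

theorem lowering_of_isHomogeneous_zero (d : σ → ℕ) {f : MvPolynomial σ K}
    (hf : f.IsHomogeneous 0) : lowering d f = 0 := by
  rw [← totalDegree_zero_iff_isHomogeneous, totalDegree_eq_zero_iff_eq_C] at hf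
  rw [hf]
  simp [lowering]

theorem isHomogeneous_lowering (d : σ → ℕ) {f : MvPolynomial σ K} {m : ℕ}
    (hf : f.IsHomogeneous (m + 1)) : (lowering d f).IsHomogeneous m := by
  refine IsHomogeneous.sum _ _ _ fun i _ ↦ IsHomogeneous.sub ?_ ?_
  · rw [← nsmul_eq_mul]
    exact (homogeneousSubmodule σ K m).smul_of_tower_mem (d i) hf.pderiv
  · obtain _ | m := m
    · have h : (pderiv i f).IsHomogeneous 0 := hf.pderiv
      rw [← totalDegree_zero_iff_isHomogeneous, totalDegree_eq_zero_iff_eq_C] at h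
      rw [h, pderiv_C, mul_zero]
      exact isHomogeneous_zero _ _ _
    · rw [add_comm m]
      exact (isHomogeneous_X K i).mul hf.pderiv.pderiv

theorem isHomogeneous_sum_X : (∑ i, X i : MvPolynomial σ K).IsHomogeneous 1 :=
  IsHomogeneous.sum _ _ _ fun i _ ↦ isHomogeneous_X K i

theorem lowering_sum_X_mul (d : σ → ℕ) {f : MvPolynomial σ K} {m : ℕ} (hf : f.IsHomogeneous m) :
    lowering d ((∑ i, X i) * f) =
      (∑ i, X i) * lowering d f + ((∑ i, (d i : ℤ) - 2 * m : ℤ) : MvPolynomial σ K) * f := by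
  classical
  have hX (i : σ) : pderiv i (∑ j, X j : MvPolynomial σ K) = 1 := by
    simp [pderiv_X, Pi.single_apply]
  have h := hf.sum_X_mul_pderiv
  rw [nsmul_eq_mul] at h
  have h' : ((∑ i, (d i : ℤ) - 2 * m : ℤ) : MvPolynomial σ K) * f =
      ∑ i, ((d i : MvPolynomial σ K) * f - 2 * (X i * pderiv i f)) := by
    rw [Finset.sum_sub_distrib, ← Finset.mul_sum, h, ← Finset.sum_mul]
    push_cast
    ring
  rw [h', lowering, lowering, Finset.mul_sum, ← Finset.sum_add_distrib]
  refine Finset.sum_congr rfl fun i _ ↦ ?_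
  simp only [Derivation.leibniz, hX, map_add, smul_eq_mul, Derivation.map_one_eq_zero]
  ring

theorem lowering_mem_powIdeal {d : σ → ℕ} {f : MvPolynomial σ K} (hf : f ∈ powIdeal K d) :
    lowering d f ∈ powIdeal K d := by
  classical
  refine Submodule.span_induction (p := fun f _ ↦ ∀ g, lowering d (g * f) ∈ powIdeal K d)
    ?_ ?_ ?_ ?_ hf 1 |> fun h ↦ by simpa using h
  · rintro _ ⟨i, rfl⟩ g
    have hmem : (X i ^ (d i + 1) : MvPolynomial σ K) ∈ powIdeal K d :=
      Ideal.subset_span ⟨i, rfl⟩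
    refine Ideal.sum_mem _ fun j _ ↦ ?_
    obtain rfl | hij := eq_or_ne j i
    · refine Ideal.mem_of_dvd _ (Dvd.intro ((d j : MvPolynomial σ K) * pderiv j g
        - X j * pderiv j (pderiv j g) - 2 * ((d j : MvPolynomial σ K) + 1) * pderiv j g) ?_) hmem
      rcases d j with _ | e
      · simp
        ring
      · simp only [Derivation.leibniz, Derivation.leibniz_pow, pderiv_X_self, map_add, smul_eq_mul,
          nsmul_eq_mul, Nat.add_sub_cancel, Nat.cast_add, Nat.cast_one,
          Derivation.map_natCast, Derivation.map_one_eq_zero]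
        ring
    · have h0 : pderiv j (X i ^ (d i + 1) : MvPolynomial σ K) = 0 := by
        simp [Derivation.leibniz_pow, pderiv_X_of_ne hij.symm]
      refine Ideal.mem_of_dvd _ (Dvd.intro ((d j : MvPolynomial σ K) * pderiv j g
        - X j * pderiv j (pderiv j g)) ?_) hmem
      simp only [Derivation.leibniz, h0, map_add, smul_eq_mul, map_zero]
      ring
  · simp [lowering_zero]
  · intro f g _ _ hf hg h
    rw [mul_add, lowering_add]
    exact add_mem (hf h) (hg h)
  · intro a f _ hf g
    rw [smul_eq_mul, ← mul_assoc]
    exact hf _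

/-- In degrees below half of the socle degree, multiplication by `∑ i, xᵢ` is injective modulo
`powIdeal K d`. -/
theorem IsHomogeneous.mem_powIdeal_of_sum_X_mul_mem [CharZero K] {d : σ → ℕ}
    {f : MvPolynomial σ K} {m : ℕ} (hf : f.IsHomogeneous m) (hm : 2 * m < ∑ i, d i)
    (h : (∑ i, X i) * f ∈ powIdeal K d) : f ∈ powIdeal K d := by
  have hD : (2 * m : ℤ) < ∑ i, (d i : ℤ) := by exact_mod_cast hm
  have hhom (k : ℕ) (hk : k ≤ m) : ((lowering d)^[k] f).IsHomogeneous (m - k) := by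
    induction k with
    | zero => exact hf
    | succ k ih =>
      rw [Function.iterate_succ_apply']
      refine isHomogeneous_lowering d ?_
      convert! ih (by omega) using 1
      omega
  have hrel (k : ℕ) (hk : k ≤ m) : (∑ i, X i) * (lowering d)^[k + 1] f +
      (((k + 1) * (∑ i, (d i : ℤ) - 2 * m + k) : ℤ) : MvPolynomial σ K) *
        (lowering d)^[k] f ∈ powIdeal K d := by
    induction k with
    | zero =>
      convert! lowering_mem_powIdeal h using 1
      rw [lowering_sum_X_mul d hf]
      simp
    | succ k ih =>
      convert! lowering_mem_powIdeal (ih (by omega)) using 1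
      rw [lowering_add, lowering_intCast_mul, lowering_sum_X_mul d (hhom (k + 1) hk),
        ← Function.iterate_succ_apply' (lowering d) (k + 1),
        ← Function.iterate_succ_apply' (lowering d) k, Nat.cast_sub hk]
      push_cast
      ring
  have htop : (lowering d)^[m + 1] f ∈ powIdeal K d := by
    have h0 := hhom m le_rfl
    rw [Nat.sub_self] at h0
    rw [Function.iterate_succ_apply', lowering_of_isHomogeneous_zero d h0]
    exact zero_mem _
  have hdown (k : ℕ) (hk : k ≤ m + 1) (hmem : (lowering d)^[k] f ∈ powIdeal K d) :
      f ∈ powIdeal K d := by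
    induction k with
    | zero => exact hmem
    | succ k ih =>
      refine ih (by omega) ?_
      have hc : ((k + 1) * (∑ i, (d i : ℤ) - 2 * m + k) : ℤ) ≠ 0 :=
        (mul_pos (by omega) (by omega)).ne'
      rw [← intCast_mul_mem_iff hc]
      exact (Ideal.add_mem_iff_right _ (Ideal.mul_mem_left _ _ hmem)).mp (hrel k (by omega))
  exact hdown (m + 1) le_rfl htop

theorem lowering_sum_X_pow_mul (d : σ → ℕ) {f : MvPolynomial σ K} {m : ℕ}
    (hf : f.IsHomogeneous m) (k : ℕ) :
    lowering d ((∑ i, X i) ^ (k + 1) * f) = (∑ i, X i) ^ (k + 1) * lowering d f +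
      (((k + 1) * (∑ i, (d i : ℤ) - 2 * m - k) : ℤ) : MvPolynomial σ K) *
        ((∑ i, X i) ^ k * f) := by
  induction k with
  | zero => simpa using lowering_sum_X_mul d hf
  | succ k ih =>
    rw [pow_succ', mul_assoc, lowering_sum_X_mul d ((isHomogeneous_sum_X.pow (k + 1)).mul hf), ih]
    push_cast
    ring

/-- In degrees above half of the socle degree, every form is divisible by `∑ i, xᵢ` modulo
`powIdeal K d`. -/
theorem IsHomogeneous.mem_powIdeal_sup_span [CharZero K] {d : σ → ℕ}
    {f : MvPolynomial σ K} {m : ℕ} (hf : f.IsHomogeneous m) (hm : ∑ i, d i < 2 * m) :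
    f ∈ powIdeal K d ⊔ Ideal.span {∑ i, X i} := by
  have hD : ∑ i, (d i : ℤ) < 2 * m := by exact_mod_cast hm
  have key (k : ℕ) : ∀ f : MvPolynomial σ K, f.IsHomogeneous m →
      (∑ i, X i) ^ k * f ∈ powIdeal K d → f ∈ powIdeal K d ⊔ Ideal.span {∑ i, X i} := by
    induction k with
    | zero =>
      intro f _ h
      exact Ideal.mem_sup_left (by simpa using h)
    | succ k ih =>
      intro f hf h
      obtain ⟨m, rfl⟩ : ∃ l, m = l + 1 := ⟨m - 1, by omega⟩
      set c : ℤ := (k + 1) * (∑ i, (d i : ℤ) - 2 * (m + 1 : ℕ) - k) with hc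
      have hc0 : c ≠ 0 := (mul_neg_of_pos_of_neg (by omega) (by omega)).ne
      have hhom : ((∑ i, X i) * lowering d f + (c : MvPolynomial σ K) * f).IsHomogeneous
          (m + 1) := by
        refine IsHomogeneous.add ?_ ?_
        · rw [add_comm m]
          exact isHomogeneous_sum_X.mul (isHomogeneous_lowering d hf)
        · rw [← zsmul_eq_mul]
          exact (homogeneousSubmodule σ K (m + 1)).smul_of_tower_mem c hf
      have hmem := ih _ hhom <| by
        convert! lowering_mem_powIdeal h using 1
        rw [lowering_sum_X_pow_mul d hf, ← hc]
        ring
      rw [← intCast_mul_mem_iff hc0]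
      exact (Ideal.add_mem_iff_right _ (Ideal.mem_sup_right
        (Ideal.mul_mem_right _ _ (Ideal.mem_span_singleton_self _)))).mp hmem
  exact key (∑ i, d i + 1) f hf
    (((isHomogeneous_sum_X.pow _).mul hf).mem_powIdeal_of_lt (by omega))

end Lowering

end MvPolynomial

theorem LinearMap.finrank_map_add_finrank_inf_ker {K V W : Type*} [Field K] [AddCommGroup V]
    [Module K V] [AddCommGroup W] [Module K W] (f : V →ₗ[K] W) (p : Submodule K V)
    [FiniteDimensional K p] :
    Module.finrank K (p.map f) + Module.finrank K (p ⊓ LinearMap.ker f : Submodule K V) =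
      Module.finrank K p := by
  rw [← (f.domRestrict p).finrank_range_add_finrank_ker, LinearMap.range_domRestrict,
    LinearMap.ker_domRestrict, ← Submodule.finrank_map_subtype_eq p, Submodule.map_comap_subtype]

section GradedPiece

variable {n : ℕ} {F : Type*} [Field F]

instance (I : Ideal (MvPolynomial (Fin n) F)) (m : ℕ) :
    FiniteDimensional F (gradedPiece F I m) := by
  have : FiniteDimensional F (homogeneousSubmodule (Fin n) F m) :=
    Module.Finite.iff_fg.mpr (homogeneousSubmodule_fg _ _ m)
  unfold gradedPiece
  infer_instance

theorem mem_gradedPiece {I : Ideal (MvPolynomial (Fin n) F)} {m : ℕ}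
    {x : MvPolynomial (Fin n) F ⧸ I} :
    x ∈ gradedPiece F I m ↔ ∃ f, f.IsHomogeneous m ∧ Ideal.Quotient.mk I f = x :=
  Iff.rfl

/-- The dimension of a graded piece modulo `powIdeal F d` counts the monomials of that degree whose
exponents are bounded by `d`. -/
theorem finrank_gradedPiece_powIdeal (d : Fin n → ℕ) (m : ℕ) :
    Module.finrank F (gradedPiece F (powIdeal F d) m) =
      Finset.card {a ∈ Fintype.piFinset fun i ↦ Finset.range (d i + 1) | ∑ i, a i = m} := by
  classical
  set S : Finset (Fin n → ℕ) :=
    {a ∈ Fintype.piFinset fun i ↦ Finset.range (d i + 1) | ∑ i, a i = m} with hS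
  have mem_S {a : Fin n → ℕ} : a ∈ S ↔ (∀ i, a i ≤ d i) ∧ ∑ i, a i = m := by
    simp [hS]
  let v (a : S) : MvPolynomial (Fin n) F ⧸ powIdeal F d :=
    Ideal.Quotient.mkₐ F _ (monomial (Finsupp.equivFunOnFinite.symm a.1) 1)
  have hv : LinearIndependent F v := by
    rw [Fintype.linearIndependent_iff]
    intro g hg a
    have hmem : ∑ b : S, g b • monomial (Finsupp.equivFunOnFinite.symm b.1) (1 : F) ∈
        powIdeal F d := by
      rw [← Ideal.Quotient.eq_zero_iff_mem]
      change Ideal.Quotient.mkₐ F (powIdeal F d) _ = 0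
      rw [map_sum]
      simpa only [v, ← map_smul] using hg
    rw [mem_powIdeal_iff] at hmem
    by_contra ha
    obtain ⟨i, hi⟩ := hmem (Finsupp.equivFunOnFinite.symm a.1) (by
      simpa [coeff_sum, coeff_monomial, Subtype.coe_inj] using ha)
    exact hi.not_ge ((mem_S.mp a.2).1 i)
  have hspan : gradedPiece F (powIdeal F d) m = Submodule.span F (Set.range v) := by
    refine le_antisymm ?_ (Submodule.span_le.mpr ?_)
    · rintro _ ⟨f, hf, rfl⟩
      rw [← f.support_sum_monomial_coeff, map_sum]
      refine Submodule.sum_mem _ fun a ha ↦ ?_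
      have hdeg := hf.degree_eq_sum_deg_support ha
      rw [← Finsupp.degree_apply, Finsupp.degree_eq_sum] at hdeg
      rw [← mul_one (coeff a f), ← smul_eq_mul, ← smul_monomial, map_smul]
      refine Submodule.smul_mem _ _ ?_
      by_cases h : ∀ i, a i ≤ d i
      · exact Submodule.subset_span ⟨⟨a, mem_S.mpr ⟨h, hdeg.symm⟩⟩, by simp [v]⟩
      · convert! Submodule.zero_mem _
        refine Ideal.Quotient.eq_zero_iff_mem.mpr (mem_powIdeal_iff.mpr fun b hb ↦ ?_)
        obtain rfl := Finset.mem_singleton.mp (support_monomial_subset hb)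
        simpa using h
    · rintro _ ⟨a, rfl⟩
      refine ⟨_, isHomogeneous_monomial _ ?_, rfl⟩
      simpa [Finsupp.degree_eq_sum] using (mem_S.mp a.2).2
  rw [hspan, finrank_span_eq_card hv, Fintype.card_coe]

theorem coeff_prod_sum_X_pow (d : Fin n → ℕ) (m : ℕ) :
    (∏ i, ∑ j ∈ Finset.range (d i + 1), Polynomial.X ^ j : Polynomial ℤ).coeff m =
      Finset.card {a ∈ Fintype.piFinset fun i ↦ Finset.range (d i + 1) | ∑ i, a i = m} := by
  simp [Finset.prod_univ_sum, Finset.prod_pow_eq_pow_sum, Polynomial.coeff_X_pow,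
    eq_comm]

theorem gradedPiece_sup_eq_bot [CharZero F] {d : Fin n → ℕ} {m : ℕ} (hm : ∑ i, d i < 2 * m) :
    gradedPiece F (powIdeal F d ⊔ Ideal.span {∑ i, X i}) m = ⊥ := by
  rw [eq_bot_iff]
  rintro _ ⟨f, hf, rfl⟩
  exact Ideal.Quotient.eq_zero_iff_mem.mpr (IsHomogeneous.mem_powIdeal_sup_span hf hm)

/-- The projection from the quotient by `powIdeal F d` to the quotient by
`powIdeal F d` and `∑ i, xᵢ`. -/
noncomputable def quotientPowIdealProj (F : Type*) [Field F] (d : Fin n → ℕ) :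
    (MvPolynomial (Fin n) F ⧸ powIdeal F d) →ₗ[F]
      MvPolynomial (Fin n) F ⧸ (powIdeal F d ⊔ Ideal.span {∑ i, X i}) :=
  (Ideal.Quotient.factorₐ F le_sup_left).toLinearMap

theorem map_quotientPowIdealProj_gradedPiece (d : Fin n → ℕ) (m : ℕ) :
    (gradedPiece F (powIdeal F d) m).map (quotientPowIdealProj F d) =
      gradedPiece F (powIdeal F d ⊔ Ideal.span {∑ i, X i}) m := by
  rw [gradedPiece, ← Submodule.map_comp]
  rfl

theorem exists_of_mem_sup {d : Fin n → ℕ} {f : MvPolynomial (Fin n) F}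
    (hf : f ∈ powIdeal F d ⊔ Ideal.span {∑ i, X i}) :
    ∃ j ∈ powIdeal F d, ∃ g, j + (∑ i, X i) * g = f := by
  obtain ⟨j, hj, l, hl, rfl⟩ := Submodule.mem_sup.mp hf
  obtain ⟨g, rfl⟩ := Ideal.mem_span_singleton.mp hl
  exact ⟨j, hj, g, rfl⟩

theorem gradedPiece_zero_inf_ker (d : Fin n → ℕ) :
    gradedPiece F (powIdeal F d) 0 ⊓ LinearMap.ker (quotientPowIdealProj F d) = ⊥ := by
  rw [eq_bot_iff]
  rintro _ ⟨⟨f, hf, rfl⟩, hker⟩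
  obtain ⟨j, hj, g, rfl⟩ := exists_of_mem_sup (Ideal.Quotient.eq_zero_iff_mem.mp hker)
  have h := homogeneousComponent_eq_self hf
  rw [map_add, homogeneousComponent_mul_of_lt isHomogeneous_sum_X g one_pos, add_zero] at h
  refine Ideal.Quotient.eq_zero_iff_mem.mpr ?_
  rw [← h]
  exact homogeneousComponent_mem_powIdeal hj 0

theorem gradedPiece_succ_inf_ker (d : Fin n → ℕ) (m : ℕ) :
    gradedPiece F (powIdeal F d) (m + 1) ⊓ LinearMap.ker (quotientPowIdealProj F d) =
      (gradedPiece F (powIdeal F d) m).map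
        (LinearMap.mulLeft F (Ideal.Quotient.mk (powIdeal F d) (∑ i, X i))) := by
  refine le_antisymm ?_ ?_
  · rintro _ ⟨⟨f, hf, rfl⟩, hker⟩
    obtain ⟨j, hj, g, rfl⟩ := exists_of_mem_sup (Ideal.Quotient.eq_zero_iff_mem.mp hker)
    have h := homogeneousComponent_eq_self hf
    rw [map_add, add_comm m, homogeneousComponent_add_mul isHomogeneous_sum_X] at h
    refine ⟨_, ⟨_, homogeneousComponent_isHomogeneous m g, rfl⟩, ?_⟩
    rw [← h]
    refine (Ideal.Quotient.eq.mpr ?_).symm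
    rw [add_sub_cancel_right]
    exact homogeneousComponent_mem_powIdeal hj (1 + m)
  · rintro _ ⟨_, ⟨f, hf, rfl⟩, rfl⟩
    refine ⟨⟨(∑ i, X i) * f, ?_, map_mul (Ideal.Quotient.mk _) _ _⟩, ?_⟩
    · rw [add_comm m]
      exact isHomogeneous_sum_X.mul hf
    · exact Ideal.Quotient.eq_zero_iff_mem.mpr (Ideal.mem_sup_right
        (Ideal.mul_mem_right _ _ (Ideal.mem_span_singleton_self _)))

theorem gradedPiece_inf_ker_mulLeft [CharZero F] {d : Fin n → ℕ} {m : ℕ}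
    (hm : 2 * m < ∑ i, d i) :
    gradedPiece F (powIdeal F d) m ⊓
      LinearMap.ker (LinearMap.mulLeft F (Ideal.Quotient.mk (powIdeal F d) (∑ i, X i))) = ⊥ := by
  rw [eq_bot_iff]
  rintro _ ⟨⟨f, hf, rfl⟩, hker⟩
  exact Ideal.Quotient.eq_zero_iff_mem.mpr (IsHomogeneous.mem_powIdeal_of_sum_X_mul_mem hf hm
    (Ideal.Quotient.eq_zero_iff_mem.mp hker))

end GradedPiece

/-- The Hilbert series of `R_𝐝 = 𝔽[x₁,…,xₙ]/(x₁^{d₁+1},…,xₙ^{dₙ+1}, x₁+⋯+xₙ)`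
is the truncation to degrees `≤ d/2` of `(1-q) ∏ᵢ (1 + q + ⋯ + q^{dᵢ})`,
where `d = d₁ + ⋯ + dₙ`. -/
theorem hilbert_series_oneRowQuotient
    {n : ℕ} (F : Type*) [Field F] [CharZero F]
    (dvec : Fin n → ℕ) (d : ℕ) (hd : d = ∑ i, dvec i)
    (I : Ideal (MvPolynomial (Fin n) F))
    (hI : I = Ideal.span ({f | ∃ i : Fin n, f = X i ^ (dvec i + 1)} ∪
        {∑ i : Fin n, X i})) :
    ∀ m : ℕ,
      (Module.finrank F (gradedPiece F I m) : ℤ) =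
        if 2 * m ≤ d then
          ((1 - Polynomial.X) *
            ∏ i : Fin n, (∑ j ∈ Finset.range (dvec i + 1), Polynomial.X ^ j) :
              Polynomial ℤ).coeff m
        else 0 := by
  intro m
  rw [Ideal.span_union] at hI
  change I = powIdeal F dvec ⊔ _ at hI
  subst hI hd
  split_ifs with hm
  · have hdim := (quotientPowIdealProj F dvec).finrank_map_add_finrank_inf_ker
      (gradedPiece F (powIdeal F dvec) m)
    rw [map_quotientPowIdealProj_gradedPiece, finrank_gradedPiece_powIdeal] at hdim
    rw [sub_mul, one_mul, Polynomial.coeff_sub, coeff_prod_sum_X_pow, ← hdim]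
    obtain _ | m := m
    · simp [gradedPiece_zero_inf_ker]
    · have hmul := (LinearMap.mulLeft F
        (Ideal.Quotient.mk (powIdeal F dvec) (∑ i, X i))).finrank_map_add_finrank_inf_ker
        (gradedPiece F (powIdeal F dvec) m)
      rw [gradedPiece_inf_ker_mulLeft (by omega), finrank_bot, add_zero,
        finrank_gradedPiece_powIdeal] at hmul
      rw [Polynomial.coeff_X_mul, coeff_prod_sum_X_pow, gradedPiece_succ_inf_ker, hmul]
      push_cast
      ring
  · rw [gradedPiece_sup_eq_bot (by omega), finrank_bot, Nat.cast_zero]
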